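/- The optimal profile problem is solvable: there exists a non-decreasing function φ : ℝ → [α', β'] with φ(x) → α' as x → −∞ and φ(x) → β' as x → +∞ such that G₁[φ, ℝ] = κ_s, where κ_s := inf{ G₁[v, ℝ] : v measurable with G₁[v, ℝ] < ∞, v(x) → α' as x → −∞, v(x) → β' as x → +∞ }. -/

import Mathlib

open Real MeasureTheory Set Filter
open scoped ENNReal

/-- The Gagliardo-type double integral ∬_{E×E} |v(x') − v(x)|²/|x' − x|^{1+2s} dx' dx. -/
noncomputable def gag (s : ℝ) (E : Set ℝ) (v : ℝ → ℝ) : ℝ≥0∞ :=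
  ∫⁻ x in E, ∫⁻ x' in E, ENNReal.ofReal ((v x' - v x) ^ 2 / |x' - x| ^ (1 + 2 * s))

/-- The functional G₁[v, ℝ] := (1/D) ∬ |v(x)−v(x')|²/|x−x'|^{1+2s} + ∫ V(v). -/
noncomputable def Gone (D s : ℝ) (V : ℝ → ℝ) (v : ℝ → ℝ) : ℝ≥0∞ :=
  ENNReal.ofReal (1 / D) * gag s univ v + ∫⁻ x, ENNReal.ofReal (V (v x))

/-- The optimal-profile constant
κ_s := inf { G₁[v, ℝ] : v measurable, G₁[v, ℝ] < ∞, v → α' at −∞, v → β' at +∞ }. -/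
noncomputable def kappa (D s α' β' : ℝ) (V : ℝ → ℝ) : ℝ≥0∞ :=
  sInf {t : ℝ≥0∞ | ∃ v : ℝ → ℝ, Measurable v ∧ Gone D s V v ≠ ⊤ ∧
    Tendsto v atBot (nhds α') ∧ Tendsto v atTop (nhds β') ∧ t = Gone D s V v}

theorem gag_univ_eq_lintegral_shift (s : ℝ) {w : ℝ → ℝ} (hw : Measurable w) :
    gag s univ w = ∫⁻ z, ENNReal.ofReal (1 / |z| ^ (1 + 2 * s)) *
      ∫⁻ x, ENNReal.ofReal ((w (x + z) - w x) ^ 2) := by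
  have h1 : gag s univ w = ∫⁻ x, ∫⁻ z, ENNReal.ofReal (1 / |z| ^ (1 + 2 * s)) *
      ENNReal.ofReal ((w (x + z) - w x) ^ 2) := by
    simp only [gag, Measure.restrict_univ]
    refine lintegral_congr fun x => ?_
    rw [← lintegral_add_left_eq_self _ x]
    refine lintegral_congr fun z => ?_
    rw [← ENNReal.ofReal_mul (by positivity), add_sub_cancel_left, one_div_mul_eq_div]
  rw [h1, lintegral_lintegral_swap (by fun_prop)]
  exact lintegral_congr fun z => lintegral_const_mul _ (by fun_prop)

theorem lintegral_shift_neg (w : ℝ → ℝ) (z : ℝ) :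
    ∫⁻ x, ENNReal.ofReal ((w (x + -z) - w x) ^ 2) =
      ∫⁻ x, ENNReal.ofReal ((w (x + z) - w x) ^ 2) := by
  rw [← lintegral_add_right_eq_self _ z]
  refine lintegral_congr fun x => ?_
  rw [add_neg_cancel_right, ← neg_sub, neg_sq]

theorem gag_le_gag_of_shift_le (s : ℝ) {u w : ℝ → ℝ} (hu : Measurable u) (hw : Measurable w)
    (h : ∀ z > 0, ∫⁻ x, ENNReal.ofReal ((u (x + z) - u x) ^ 2) ≤
      ∫⁻ x, ENNReal.ofReal ((w (x + z) - w x) ^ 2)) :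
    gag s univ u ≤ gag s univ w := by
  rw [gag_univ_eq_lintegral_shift s hu, gag_univ_eq_lintegral_shift s hw]
  refine lintegral_mono fun z => mul_le_mul_right ?_ _
  rcases lt_trichotomy z 0 with hz | rfl | hz
  · have := h (-z) (by linarith)
    rwa [lintegral_shift_neg, lintegral_shift_neg] at this
  · simp
  · exact h z hz

/-- The signed position at which the monotone rearrangement of `w` crosses the level `t`. -/
noncomputable def crossing (w : ℝ → ℝ) (t : ℝ) : ℝ :=
  volume.real (Ioi 0 ∩ {x | w x ≤ t}) - volume.real (Iic 0 \ {x | w x ≤ t})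

theorem exists_transition_radius {w : ℝ → ℝ} {α β σ τ : ℝ}
    (hbot : Tendsto w atBot (nhds α)) (htop : Tendsto w atTop (nhds β))
    (hσ : α < σ) (hτ : τ < β) :
    ∃ M : ℝ, 0 ≤ M ∧ (∀ x ≤ -M, w x ≤ σ) ∧ ∀ x > M, τ < w x := by
  obtain ⟨a, ha⟩ := eventually_atBot.1 (hbot.eventually_lt_const hσ)
  obtain ⟨b, hb⟩ := eventually_atTop.1 (htop.eventually_const_lt hτ)
  refine ⟨max 0 (max (-a) b), le_max_left _ _, fun x hx => (ha x ?_).le, fun x hx => hb x ?_⟩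
  · have := le_max_left (-a) b
    have := le_max_right 0 (max (-a) b)
    linarith
  · have := le_max_right (-a) b
    have := le_max_right 0 (max (-a) b)
    linarith

theorem volume_real_sublevel {w : ℝ → ℝ} (hw : Measurable w) {t M L R : ℝ} (hM : 0 ≤ M)
    (hlo : ∀ x ≤ -M, w x ≤ t) (hhi : ∀ x > M, t < w x) (hL : M ≤ L) (hR : M ≤ R) :
    volume.real (Ioc (-L) R ∩ {x | w x ≤ t}) = L + crossing w t := by
  have hS : MeasurableSet {x | w x ≤ t} := measurableSet_le hw measurable_const
  have e1 : Ioc (-L) R ∩ {x | w x ≤ t} =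
      (Ioc (-L) 0 ∩ {x | w x ≤ t}) ∪ (Ioi 0 ∩ {x | w x ≤ t}) := by
    ext x
    simp only [mem_inter_iff, mem_Ioc, mem_ofPred_eq, mem_union, mem_Ioi]
    constructor
    · rintro ⟨⟨h1, h2⟩, h3⟩
      rcases le_or_gt x 0 with h | h
      · exact Or.inl ⟨⟨h1, h⟩, h3⟩
      · exact Or.inr ⟨h, h3⟩
    · rintro (⟨⟨h1, h2⟩, h3⟩ | ⟨h1, h3⟩)
      · exact ⟨⟨h1, by linarith⟩, h3⟩
      · refine ⟨⟨by linarith, ?_⟩, h3⟩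
        by_contra! h
        exact absurd h3 (not_le.2 (hhi x (by linarith)))
  have e2 : Iic 0 \ {x | w x ≤ t} = Ioc (-L) 0 \ {x | w x ≤ t} := by
    ext x
    simp only [Set.mem_sdiff, mem_Ioc, mem_ofPred_eq, mem_Iic]
    refine ⟨fun ⟨h1, h2⟩ => ⟨⟨?_, h1⟩, h2⟩, fun ⟨h1, h2⟩ => ⟨h1.2, h2⟩⟩
    by_contra! h
    exact h2 (hlo x (by linarith))
  have e3 : volume.real (Ioc (-L) 0 ∩ {x | w x ≤ t}) +
      volume.real (Ioc (-L) 0 \ {x | w x ≤ t}) = L := by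
    rw [measureReal_inter_add_sdiff hS (by simp), Real.volume_real_Ioc_of_le (by linarith)]
    ring
  have hfin : volume (Ioi 0 ∩ {x | w x ≤ t}) ≠ ⊤ := by
    have hsub : Ioi 0 ∩ {x | w x ≤ t} ⊆ Ioc 0 M :=
      fun x hx => ⟨hx.1, not_lt.1 fun h => absurd hx.2 (not_le.2 (hhi x h))⟩
    exact measure_ne_top_of_subset hsub measure_Ioc_lt_top.ne
  have hfin' : volume (Ioc (-L) 0 ∩ {x | w x ≤ t}) ≠ ⊤ :=
    measure_ne_top_of_subset inter_subset_left (by simp)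
  rw [e1, measureReal_union ?_ (measurableSet_Ioi.inter hS) hfin' hfin, crossing, e2]
  · linarith
  · exact Set.disjoint_left.2 fun x hx hx' => absurd hx.1.2 (not_le.2 hx'.1)

theorem volume_between_levels {w : ℝ → ℝ} (hw : Measurable w) {α β σ τ : ℝ}
    (hbot : Tendsto w atBot (nhds α)) (htop : Tendsto w atTop (nhds β))
    (hσ : α < σ) (hστ : σ ≤ τ) (hτ : τ < β) :
    crossing w σ ≤ crossing w τ ∧
      volume {x | σ < w x ∧ w x ≤ τ} = ENNReal.ofReal (crossing w τ - crossing w σ) := by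
  obtain ⟨M, hM, hlo, hhi⟩ := exists_transition_radius hbot htop hσ hτ
  have hS : MeasurableSet {x | w x ≤ σ} := measurableSet_le hw measurable_const
  have v1 := volume_real_sublevel hw hM hlo (fun x hx => hστ.trans_lt (hhi x hx)) le_rfl le_rfl
  have v2 := volume_real_sublevel hw hM (fun x hx => (hlo x hx).trans hστ) hhi le_rfl le_rfl
  have hsub : Ioc (-M) M ∩ {x | w x ≤ σ} ⊆ Ioc (-M) M ∩ {x | w x ≤ τ} :=
    fun x hx => ⟨hx.1, le_trans hx.2 hστ⟩
  have hfin : volume (Ioc (-M) M ∩ {x | w x ≤ τ}) ≠ ⊤ :=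
    measure_ne_top_of_subset inter_subset_left (by simp)
  have e : {x | σ < w x ∧ w x ≤ τ} =
      (Ioc (-M) M ∩ {x | w x ≤ τ}) \ (Ioc (-M) M ∩ {x | w x ≤ σ}) := by
    ext x
    simp only [Set.mem_sdiff, mem_Ioc, mem_ofPred_eq, mem_inter_iff, not_and, not_le]
    refine ⟨fun ⟨h1, h2⟩ => ⟨⟨⟨?_, ?_⟩, h2⟩, fun _ => h1⟩, fun ⟨⟨h1, h2⟩, h3⟩ => ⟨h3 h1, h2⟩⟩
    · by_contra! h
      exact absurd (hlo x h) (not_le.2 h1)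
    · by_contra! h
      exact absurd h2 (not_le.2 (hhi x h))
  have hd := measureReal_sdiff hsub (measurableSet_Ioc.inter hS) hfin
  have hle := measureReal_mono hsub hfin
  refine ⟨by linarith, ?_⟩
  rw [e, ← ofReal_measureReal (measure_ne_top_of_subset sdiff_subset hfin), hd]
  congr 1
  linarith

theorem le_crossing_of_forall_gt {w : ℝ → ℝ} (hw : Measurable w) {α β t y : ℝ}
    (hbot : Tendsto w atBot (nhds α)) (htop : Tendsto w atTop (nhds β))
    (ht : t ∈ Ioo α β) (h : ∀ r ∈ Ioo t β, y ≤ crossing w r) : y ≤ crossing w t := by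
  obtain ⟨τ, htτ, hτ⟩ := exists_between ht.2
  obtain ⟨M, hM, hlo, hhi⟩ := exists_transition_radius hbot htop ht.1 hτ
  have hlim := tendsto_measure_biInter_gt (μ := volume) (a := t)
    (s := fun r => Ioc (-M) M ∩ {x | w x ≤ r})
    (fun r _ => (measurableSet_Ioc.inter (measurableSet_le hw measurable_const)).nullMeasurableSet)
    (fun i j _ hij x hx => ⟨hx.1, le_trans hx.2 hij⟩)
    ⟨τ, htτ, measure_ne_top_of_subset inter_subset_left (by simp)⟩
  have e : ⋂ r > t, Ioc (-M) M ∩ {x | w x ≤ r} = Ioc (-M) M ∩ {x | w x ≤ t} := by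
    ext x
    simp only [mem_iInter, mem_inter_iff, mem_ofPred_eq]
    exact ⟨fun hx => ⟨(hx τ htτ).1, le_of_forall_gt_imp_ge_of_dense fun r hr => (hx r hr).2⟩,
      fun hx r hr => ⟨hx.1, hx.2.trans hr.le⟩⟩
  rw [e] at hlim
  have hge : ENNReal.ofReal (y + M) ≤ volume (Ioc (-M) M ∩ {x | w x ≤ t}) := by
    refine ge_of_tendsto hlim ?_
    filter_upwards [Ioo_mem_nhdsGT htτ] with r hr
    have v := volume_real_sublevel hw (t := r) hM (fun x hx => (hlo x hx).trans hr.1.le)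
      (fun x hx => hr.2.trans (hhi x hx)) le_rfl le_rfl
    have := h r ⟨hr.1, hr.2.trans hτ⟩
    rw [Function.comp_apply,
      ← ofReal_measureReal (measure_ne_top_of_subset inter_subset_left (by simp)), v]
    exact ENNReal.ofReal_le_ofReal (by linarith)
  have v := volume_real_sublevel hw (t := t) hM hlo
      (fun x hx => htτ.trans (hhi x hx)) le_rfl le_rfl
  rw [← ofReal_measureReal (measure_ne_top_of_subset inter_subset_left (by simp)),
    ENNReal.ofReal_le_ofReal_iff measureReal_nonneg, v] at hge
  linarith

theorem ofReal_le_volume_jump {w : ℝ → ℝ} (hw : Measurable w) {α β σ τ z : ℝ}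
    (hbot : Tendsto w atBot (nhds α)) (htop : Tendsto w atTop (nhds β))
    (hσ : α < σ) (hστ : σ ≤ τ) (hτ : τ < β) (hz : 0 < z) :
    ENNReal.ofReal (z - (crossing w τ - crossing w σ)) ≤
      volume {x | w x ≤ σ ∧ τ < w (x + z)} := by
  obtain ⟨M, hM, hlo, hhi⟩ := exists_transition_radius hbot htop hσ hτ
  have v1 := volume_real_sublevel hw (L := M + z) (R := M) hM hlo
    (fun x hx => hστ.trans_lt (hhi x hx)) (by linarith) le_rfl
  have v2 := volume_real_sublevel hw (L := M) (R := M + z) hM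
    (fun x hx => (hlo x hx).trans hστ) hhi le_rfl (by linarith)
  set A := Ioc (-(M + z)) M ∩ {x | w x ≤ σ} with hA
  set B := Ioc (-M) (M + z) ∩ {x | w x ≤ τ} with hB
  have hAf : volume A ≠ ⊤ := measure_ne_top_of_subset inter_subset_left (by simp)
  have hBf : volume B ≠ ⊤ := measure_ne_top_of_subset inter_subset_left (by simp)
  have hpre : volume ((fun x => x + z) ⁻¹' B) = volume B := measure_preimage_add_right _ _ _
  have hsub : A ⊆ {x | w x ≤ σ ∧ τ < w (x + z)} ∪ (fun x => x + z) ⁻¹' B := by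
    intro x hx
    by_cases h : τ < w (x + z)
    · exact Or.inl ⟨hx.2, h⟩
    · refine Or.inr ⟨⟨?_, ?_⟩, not_lt.1 h⟩
      · have := hx.1.1
        linarith
      · have := hx.1.2
        linarith
  have hle : volume A ≤ volume {x | w x ≤ σ ∧ τ < w (x + z)} + volume B :=
    (measure_mono hsub).trans ((measure_union_le _ _).trans_eq (by rw [hpre]))
  rw [← ofReal_measureReal hAf, ← ofReal_measureReal hBf, v1, v2, ← tsub_le_iff_right,
    ← ENNReal.ofReal_sub _ (by rw [← v2]; exact measureReal_nonneg)] at hle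
  convert hle using 2
  ring

theorem exists_monotone_inverse {α β : ℝ} (hαβ : α < β) {F : ℝ → ℝ}
    (hrc : ∀ t ∈ Ioo α β, ∀ y, (∀ r ∈ Ioo t β, y ≤ F r) → y ≤ F t)
    (hmono : MonotoneOn F (Ioo α β)) :
    ∃ u : ℝ → ℝ, Monotone u ∧ (∀ x, u x ∈ Icc α β) ∧
      ∀ t ∈ Ioo α β, ∀ x, u x ≤ t ↔ x ≤ F t := by
  have hlb : ∀ x, α ∈ lowerBounds (insert β {t | t ∈ Ioo α β ∧ x ≤ F t}) := by
    rintro x t (rfl | ht)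
    · exact hαβ.le
    · exact ht.1.1.le
  have hne : ∀ x, (insert β {t | t ∈ Ioo α β ∧ x ≤ F t}).Nonempty := fun x => ⟨β, Or.inl rfl⟩
  refine ⟨fun x => sInf (insert β {t | t ∈ Ioo α β ∧ x ≤ F t}), fun x y hxy => ?_,
    fun x => ⟨le_csInf (hne x) (hlb x), csInf_le ⟨α, hlb x⟩ (Or.inl rfl)⟩, fun t ht x => ?_⟩
  · exact csInf_le_csInf ⟨α, hlb x⟩ (hne y)
      (insert_subset_insert fun t ht => ⟨ht.1, hxy.trans ht.2⟩)
  · refine ⟨fun h => hrc t ht x fun r hr => ?_, fun h => csInf_le ⟨α, hlb x⟩ (Or.inr ⟨ht, h⟩)⟩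
    obtain ⟨q, hq, hqr⟩ := exists_lt_of_csInf_lt (hne x) (lt_of_le_of_lt h hr.1)
    rcases hq with rfl | hq
    · exact absurd hqr (not_lt.2 hr.2.le)
    · exact hq.2.trans (hmono hq.1 ⟨ht.1.trans hr.1, hr.2⟩ hqr.le)

theorem tendsto_of_monotone_inverse {α β : ℝ} (hαβ : α < β) {F u : ℝ → ℝ}
    (hu : ∀ x, u x ∈ Icc α β) (hinv : ∀ t ∈ Ioo α β, ∀ x, u x ≤ t ↔ x ≤ F t) :
    Tendsto u atBot (nhds α) ∧ Tendsto u atTop (nhds β) := by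
  constructor
  · refine tendsto_order.2 ⟨fun c hc => Eventually.of_forall fun x => hc.trans_le (hu x).1,
      fun c hc => ?_⟩
    obtain ⟨t, ht⟩ := exists_between (lt_min hc hαβ)
    filter_upwards [eventually_le_atBot (F t)] with x hx
    exact ((hinv t ⟨ht.1, ht.2.trans_le (min_le_right _ _)⟩ x).2 hx).trans_lt
      (ht.2.trans_le (min_le_left _ _))
  · refine tendsto_order.2 ⟨fun c hc => ?_,
      fun c hc => Eventually.of_forall fun x => (hu x).2.trans_lt hc⟩
    obtain ⟨t, ht⟩ := exists_between (max_lt hc hαβ)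
    filter_upwards [eventually_gt_atTop (F t)] with x hx
    exact ((le_max_left _ _).trans_lt ht.1).trans
      (not_le.1 fun h => not_le.2 hx ((hinv t ⟨(le_max_right _ _).trans_lt ht.1, ht.2⟩ x).1 h))

theorem volume_restrict_square {α β a b : ℝ} (ha : α ≤ a) (hb : b ≤ β) :
    (volume.restrict (Ioo α β ×ˢ Ioo α β)) (Ico a b ×ˢ Ico a b) =
      ENNReal.ofReal (b - a) ^ 2 := by
  have h : volume (Ico a b ∩ Ioo α β) = ENNReal.ofReal (b - a) := by
    refine le_antisymm ((measure_mono inter_subset_left).trans_eq Real.volume_Ico) ?_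
    rw [← Real.volume_Ioo]
    exact measure_mono fun x hx => ⟨⟨hx.1.le, hx.2⟩, ha.trans_lt hx.1, hx.2.trans_le hb⟩
  rw [Measure.restrict_apply (measurableSet_Ico.prod measurableSet_Ico), Set.prod_inter_prod,
    Measure.volume_eq_prod, Measure.prod_prod, h, sq]

theorem lintegral_posPart_shift_sq {α β : ℝ} {w : ℝ → ℝ} (hw : Measurable w)
    (hmem : ∀ x, w x ∈ Icc α β) (z : ℝ) :
    ∫⁻ x, ENNReal.ofReal (w (x + z) - w x) ^ 2 =
      ∫⁻ p in Ioo α β ×ˢ Ioo α β,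
        volume {x | w x ≤ min p.1 p.2 ∧ max p.1 p.2 < w (x + z)} := by
  set S : Set (ℝ × ℝ × ℝ) := {q | w q.1 ≤ min q.2.1 q.2.2} ∩
    {q | max q.2.1 q.2.2 < w (q.1 + z)} with hS
  have hSm : MeasurableSet S :=
    (measurableSet_le (by fun_prop) (by fun_prop)).inter
      (measurableSet_lt (by fun_prop) (by fun_prop))
  have h1 := Measure.prod_apply (μ := (volume : Measure ℝ))
    (ν := volume.restrict (Ioo α β ×ˢ Ioo α β)) hSm
  rw [Measure.prod_apply_symm hSm] at h1
  refine Eq.trans (lintegral_congr fun x => ?_) h1.symm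
  rw [← volume_restrict_square (hmem x).1 (hmem (x + z)).2]
  congr 1
  ext p
  simp only [hS, mem_prod, mem_Ico, mem_preimage, mem_inter_iff, mem_ofPred_eq,
    le_min_iff, max_lt_iff]
  tauto

/-- A monotone function with the level positions of `w`, up to a translation. -/
def IsIncreasingRearrangement (α β c : ℝ) (w u : ℝ → ℝ) : Prop :=
  Monotone u ∧ (∀ x, u x ∈ Icc α β) ∧
    ∀ t ∈ Ioo α β, ∀ x, u x ≤ t ↔ x ≤ crossing w t - c

theorem exists_isIncreasingRearrangement {α β : ℝ} (hαβ : α < β) (c : ℝ) {w : ℝ → ℝ}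
    (hw : Measurable w) (hbot : Tendsto w atBot (nhds α)) (htop : Tendsto w atTop (nhds β)) :
    ∃ u, IsIncreasingRearrangement α β c w u := by
  refine exists_monotone_inverse hαβ (F := fun t => crossing w t - c) (fun t ht y h => ?_)
    fun σ hσ τ hτ hστ => ?_
  · have := le_crossing_of_forall_gt (y := y + c) hw hbot htop ht
      fun r hr => by linarith [h r hr]
    linarith
  · have := (volume_between_levels hw hbot htop hσ.1 hστ hτ.2).1
    simpa using this

theorem IsIncreasingRearrangement.gag_le {α β c : ℝ} {w u : ℝ → ℝ}
    (h : IsIncreasingRearrangement α β c w u) (s : ℝ)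
    (hw : Measurable w) (hmem : ∀ x, w x ∈ Icc α β)
    (hbot : Tendsto w atBot (nhds α)) (htop : Tendsto w atTop (nhds β)) :
    gag s univ u ≤ gag s univ w := by
  obtain ⟨hmono, hu, hinv⟩ := h
  refine gag_le_gag_of_shift_le s hmono.measurable hw fun z hz => ?_
  calc ∫⁻ x, ENNReal.ofReal ((u (x + z) - u x) ^ 2)
      = ∫⁻ x, ENNReal.ofReal (u (x + z) - u x) ^ 2 :=
        lintegral_congr fun x => ENNReal.ofReal_pow (sub_nonneg.2 (hmono (by linarith))) 2
    _ ≤ ∫⁻ x, ENNReal.ofReal (w (x + z) - w x) ^ 2 := by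
        rw [lintegral_posPart_shift_sq hmono.measurable hu, lintegral_posPart_shift_sq hw hmem]
        refine setLIntegral_mono' (measurableSet_Ioo.prod measurableSet_Ioo) fun p hp => ?_
        have hσ : min p.1 p.2 ∈ Ioo α β :=
          ⟨lt_min hp.1.1 hp.2.1, (min_le_left _ _).trans_lt hp.1.2⟩
        have hτ : max p.1 p.2 ∈ Ioo α β :=
          ⟨hp.1.1.trans_le (le_max_left _ _), max_lt hp.1.2 hp.2.2⟩
        have e : {x | u x ≤ min p.1 p.2 ∧ max p.1 p.2 < u (x + z)} =
            Ioc (crossing w (max p.1 p.2) - c - z) (crossing w (min p.1 p.2) - c) := by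
          ext x
          rw [mem_ofPred_eq, hinv _ hσ, ← not_le, hinv _ hτ, not_le, mem_Ioc, and_comm]
          exact and_congr_left' sub_lt_iff_lt_add.symm
        refine le_trans (le_of_eq ?_)
          (ofReal_le_volume_jump hw hbot htop hσ.1 min_le_max hτ.2 hz)
        rw [e, Real.volume_Ioc]
        congr 1
        ring
    _ ≤ ∫⁻ x, ENNReal.ofReal ((w (x + z) - w x) ^ 2) := by
        refine lintegral_mono fun x => ?_
        rcases le_total 0 (w (x + z) - w x) with h | h
        · rw [ENNReal.ofReal_pow h]
        · simp [ENNReal.ofReal_of_nonpos h]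

theorem restrict_Ioo_eq_of_Ioc {α β : ℝ} {μ ν : Measure ℝ}
    (hfin : ∀ σ τ, α < σ → σ ≤ τ → τ < β → μ (Ioc σ τ) ≠ ⊤)
    (h : ∀ σ τ, α < σ → σ ≤ τ → τ < β → μ (Ioc σ τ) = ν (Ioc σ τ)) :
    μ.restrict (Ioo α β) = ν.restrict (Ioo α β) := by
  have key : ∀ σ τ, α < σ → τ < β → μ.restrict (Ioc σ τ) = ν.restrict (Ioc σ τ) := by
    intro σ τ hσ hτ
    rcases lt_or_ge τ σ with hlt | hστ
    · simp [Ioc_eq_empty (not_lt.2 hlt.le)]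
    have : IsFiniteMeasure (μ.restrict (Ioc σ τ)) :=
      ⟨by simpa using (hfin σ τ hσ hστ hτ).lt_top⟩
    refine Measure.ext_of_Ioc_finite _ _ (by simpa using h σ τ hσ hστ hτ) fun a b _ => ?_
    rw [Measure.restrict_apply measurableSet_Ioc, Measure.restrict_apply measurableSet_Ioc,
      Ioc_inter_Ioc]
    rcases le_total (a ⊔ σ) (b ⊓ τ) with h' | h'
    · exact h _ _ (hσ.trans_le le_sup_right) h' (inf_le_right.trans_lt hτ)
    · simp [Ioc_eq_empty (not_lt.2 h')]
  obtain ⟨σ, -, hσ, hσlim⟩ := exists_seq_strictAnti_tendsto α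
  obtain ⟨τ, -, hτ, hτlim⟩ := exists_seq_strictMono_tendsto β
  have e : Ioo α β = ⋃ n, Ioc (σ n) (τ n) := by
    ext x
    simp only [mem_iUnion]
    refine ⟨fun hx => ?_, fun ⟨n, hn⟩ => ⟨(hσ n).trans hn.1, hn.2.trans_lt (hτ n)⟩⟩
    obtain ⟨n, h1, h2⟩ :=
      ((hσlim.eventually_lt_const hx.1).and (hτlim.eventually_const_lt hx.2)).exists
    exact ⟨n, h1, h2.le⟩
  rw [e, Measure.restrict_iUnion_congr]
  exact fun n => key _ _ (hσ n) (hτ n)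

theorem lintegral_potential_eq_setLIntegral_map {α β : ℝ} {V : ℝ → ℝ} (hVc : Continuous V)
    (hα : V α = 0) (hβ : V β = 0) {u : ℝ → ℝ} (hu : Measurable u) (hmem : ∀ x, u x ∈ Icc α β) :
    ∫⁻ x, ENNReal.ofReal (V (u x)) =
      ∫⁻ t in Ioo α β, ENNReal.ofReal (V t) ∂(volume.map u) := by
  rw [← lintegral_indicator measurableSet_Ioo,
    lintegral_map (by measurability) hu]
  refine lintegral_congr fun x => ?_
  by_cases hx : u x ∈ Ioo α β
  · rw [indicator_of_mem hx]
  · rw [indicator_of_notMem hx]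
    rcases (hmem x).1.eq_or_lt with h | h
    · simp [← h, hα]
    · have : u x = β := (hmem x).2.antisymm (not_lt.1 fun h' => hx ⟨h, h'⟩)
      simp [this, hβ]

theorem IsIncreasingRearrangement.lintegral_potential_eq {α β c : ℝ} {w u : ℝ → ℝ}
    (h : IsIncreasingRearrangement α β c w u) {V : ℝ → ℝ} (hVc : Continuous V)
    (hα : V α = 0) (hβ : V β = 0) (hw : Measurable w) (hmem : ∀ x, w x ∈ Icc α β)
    (hbot : Tendsto w atBot (nhds α)) (htop : Tendsto w atTop (nhds β)) :
    ∫⁻ x, ENNReal.ofReal (V (u x)) = ∫⁻ x, ENNReal.ofReal (V (w x)) := by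
  obtain ⟨hmono, hu, hinv⟩ := h
  rw [lintegral_potential_eq_setLIntegral_map hVc hα hβ hmono.measurable hu,
    lintegral_potential_eq_setLIntegral_map hVc hα hβ hw hmem]
  have hmu : ∀ σ τ, α < σ → σ ≤ τ → τ < β →
      volume.map u (Ioc σ τ) = ENNReal.ofReal (crossing w τ - crossing w σ) := by
    intro σ τ hσ hστ hτ
    have e : u ⁻¹' Ioc σ τ = Ioc (crossing w σ - c) (crossing w τ - c) := by
      ext x
      rw [mem_preimage, mem_Ioc, ← not_le, hinv σ ⟨hσ, hστ.trans_lt hτ⟩,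
        hinv τ ⟨hσ.trans_le hστ, hτ⟩, not_le, mem_Ioc]
    rw [Measure.map_apply hmono.measurable measurableSet_Ioc, e, Real.volume_Ioc,
      sub_sub_sub_cancel_right]
  rw [restrict_Ioo_eq_of_Ioc (ν := volume.map w)
    (fun σ τ h1 h2 h3 => by rw [hmu σ τ h1 h2 h3]; exact ENNReal.ofReal_ne_top)
    fun σ τ h1 h2 h3 => ?_]
  rw [hmu σ τ h1 h2 h3, Measure.map_apply hw measurableSet_Ioc]
  exact (volume_between_levels hw hbot htop h1 h2 h3).2.symm

theorem Gone_mono {D s : ℝ} {V u w : ℝ → ℝ} (hg : gag s univ u ≤ gag s univ w)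
    (hV : ∫⁻ x, ENNReal.ofReal (V (u x)) ≤ ∫⁻ x, ENNReal.ofReal (V (w x))) :
    Gone D s V u ≤ Gone D s V w :=
  add_le_add (mul_le_mul_right hg _) hV

theorem Gone_clamp_le {α β D s : ℝ} {V : ℝ → ℝ} (hα : V α = 0) (hβ : V β = 0) (v : ℝ → ℝ) :
    Gone D s V (fun x => max (min (v x) β) α) ≤ Gone D s V v := by
  refine Gone_mono (lintegral_mono fun x => lintegral_mono fun y =>
    ENNReal.ofReal_le_ofReal ?_) (lintegral_mono fun x => ?_)
  · refine div_le_div_of_nonneg_right (sq_le_sq.2 ?_) (by positivity)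
    refine (abs_max_sub_max_le_abs _ _ _).trans ((abs_min_sub_min_le_max _ _ _ _).trans ?_)
    simp
  · dsimp only
    rcases max_choice (min (v x) β) α with h | h <;> rw [h]
    · rcases min_choice (v x) β with h' | h' <;> rw [h']
      simp [hβ]
    · simp [hα]

theorem exists_monotone_competitor {α β D s : ℝ} {V : ℝ → ℝ} (hαβ : α < β) (hVc : Continuous V)
    (hα : V α = 0) (hβ : V β = 0) {v : ℝ → ℝ} (hv : Measurable v)
    (hbot : Tendsto v atBot (nhds α)) (htop : Tendsto v atTop (nhds β)) :
    ∃ u : ℝ → ℝ, Monotone u ∧ (∀ x, u x ∈ Icc α β) ∧ (∀ x, u x ≤ (α + β) / 2 ↔ x ≤ 0) ∧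
      Tendsto u atBot (nhds α) ∧ Tendsto u atTop (nhds β) ∧ Gone D s V u ≤ Gone D s V v := by
  set w : ℝ → ℝ := fun x => max (min (v x) β) α
  have hw : Measurable w := by fun_prop
  have hmem : ∀ x, w x ∈ Icc α β := fun x =>
    ⟨le_max_right _ _, max_le (min_le_right _ _) hαβ.le⟩
  have hwbot : Tendsto w atBot (nhds α) := by
    simpa [hαβ.le] using (hbot.min (tendsto_const_nhds (x := β))).max (tendsto_const_nhds (x := α))
  have hwtop : Tendsto w atTop (nhds β) := by
    simpa [hαβ.le] using (htop.min (tendsto_const_nhds (x := β))).max (tendsto_const_nhds (x := α))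
  obtain ⟨u, hu⟩ := exists_isIncreasingRearrangement hαβ (crossing w ((α + β) / 2)) hw hwbot hwtop
  have hlim := tendsto_of_monotone_inverse hαβ hu.2.1 hu.2.2
  refine ⟨u, hu.1, hu.2.1, fun x => ?_, hlim.1, hlim.2, ?_⟩
  · simpa using hu.2.2 ((α + β) / 2) ⟨by linarith, by linarith⟩ x
  · exact (Gone_mono (hu.gag_le s hw hmem hwbot hwtop)
      (hu.lintegral_potential_eq hVc hα hβ hw hmem hwbot hwtop).le).trans (Gone_clamp_le hα hβ v)

/-- **Helly's selection theorem** for uniformly bounded monotone functions. -/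
theorem exists_subseq_ae_tendsto_of_monotone {α β : ℝ} {u : ℕ → ℝ → ℝ}
    (hmono : ∀ n, Monotone (u n)) (hmem : ∀ n x, u n x ∈ Icc α β) :
    ∃ ψ : ℕ → ℕ, StrictMono ψ ∧ ∃ φ : ℝ → ℝ, Monotone φ ∧ (∀ x, φ x ∈ Icc α β) ∧
      ∀ᵐ x, Tendsto (fun n => u (ψ n) x) atTop (nhds (φ x)) := by
  obtain ⟨g, ψ, hψ, hg⟩ := CompactSpace.tendsto_subseq
    (fun n (q : ℚ) => (⟨u n q, hmem n q⟩ : Icc α β))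
  have hlim : ∀ q : ℚ, Tendsto (fun n => u (ψ n) q) atTop (nhds (g q : ℝ)) := fun q =>
    (continuous_subtype_val.tendsto _).comp (tendsto_pi_nhds.1 hg q)
  have hgmono : ∀ p q : ℚ, p ≤ q → (g p : ℝ) ≤ g q := fun p q hpq =>
    le_of_tendsto_of_tendsto' (hlim p) (hlim q) fun n => hmono _ (by exact_mod_cast hpq)
  set S : ℝ → Set ℝ := fun x => {y | ∃ q : ℚ, (q : ℝ) < x ∧ y = g q} with hS
  have hne : ∀ x, (S x).Nonempty := fun x => (exists_rat_lt x).imp' (fun q => (g q : ℝ))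
    fun q hq => ⟨q, hq, rfl⟩
  have hub : ∀ x, β ∈ upperBounds (S x) := by
    rintro x _ ⟨q, -, rfl⟩
    exact (g q).2.2
  have hmonoφ : Monotone fun x => sSup (S x) := fun x y hxy =>
    csSup_le_csSup ⟨β, hub y⟩ (hne x) fun t ⟨q, hq, ht⟩ => ⟨q, hq.trans_le hxy, ht⟩
  refine ⟨ψ, hψ, fun x => sSup (S x), hmonoφ, fun x => ⟨?_, csSup_le (hne x) (hub x)⟩, ?_⟩
  · obtain ⟨q, hq⟩ := exists_rat_lt x
    exact (g q).2.1.trans (le_csSup ⟨β, hub x⟩ ⟨q, hq, rfl⟩)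
  filter_upwards [hmonoφ.countable_not_continuousAt.ae_notMem volume] with x hx
  have hx : ContinuousAt (fun x => sSup (S x)) x := not_not.1 hx
  refine tendsto_order.2 ⟨fun c hc => ?_, fun c hc => ?_⟩
  · obtain ⟨_, ⟨q, hqx, rfl⟩, hq⟩ := exists_lt_of_lt_csSup (hne x) hc
    filter_upwards [(hlim q).eventually_const_lt hq] with n hn
    exact hn.trans_le (hmono _ hqx.le)
  · obtain ⟨y, hy, hxy⟩ := ((hx.eventually_lt_const hc).filter_mono
      (nhdsWithin_le_nhds (s := Ioi x)) |>.and self_mem_nhdsWithin).exists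
    obtain ⟨q, hxq, hqy⟩ := exists_rat_btwn hxy
    have hgq : (g q : ℝ) < c := (le_csSup ⟨β, hub y⟩ ⟨q, hqy, rfl⟩).trans_lt hy
    filter_upwards [(hlim q).eventually_lt_const hgq] with n hn
    exact (hmono _ hxq.le).trans_lt hn

theorem lintegral_le_liminf_of_ae_tendsto {X : Type*} [MeasurableSpace X] {μ : Measure X}
    {f : ℕ → X → ℝ≥0∞} {g : X → ℝ≥0∞} (hf : ∀ n, Measurable (f n))
    (h : ∀ᵐ x ∂μ, Tendsto (fun n => f n x) atTop (nhds (g x))) :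
    ∫⁻ x, g x ∂μ ≤ liminf (fun n => ∫⁻ x, f n x ∂μ) atTop := by
  refine le_trans (le_of_eq (lintegral_congr_ae ?_)) (lintegral_liminf_le hf)
  filter_upwards [h] with x hx using hx.liminf_eq.symm

theorem gag_univ_le_liminf {s : ℝ} {u : ℕ → ℝ → ℝ} {φ : ℝ → ℝ} (hu : ∀ n, Measurable (u n))
    (h : ∀ᵐ x, Tendsto (fun n => u n x) atTop (nhds (φ x))) :
    gag s univ φ ≤ liminf (fun n => gag s univ (u n)) atTop := by
  simp only [gag, Measure.restrict_univ]
  refine le_trans (lintegral_mono_ae ?_) (lintegral_liminf_le fun n => ?_)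
  · filter_upwards [h] with x hx
    refine lintegral_le_liminf_of_ae_tendsto (fun n => by fun_prop) ?_
    filter_upwards [h] with y hy
    exact ENNReal.tendsto_ofReal (((hy.sub hx).pow 2).div_const _)
  · exact Measurable.lintegral_prod_right' (f := fun p : ℝ × ℝ =>
      ENNReal.ofReal ((u n p.2 - u n p.1) ^ 2 / |p.2 - p.1| ^ (1 + 2 * s))) (by fun_prop)

theorem liminf_add_liminf_le (a b : ℕ → ℝ≥0∞) :
    liminf a atTop + liminf b atTop ≤ liminf (fun n => a n + b n) atTop := by
  simp only [liminf_eq_iSup_iInf_of_nat]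
  rw [ENNReal.iSup_add_iSup_of_monotone
    (fun m n hmn => le_iInf₂ fun i hi => iInf₂_le i (le_trans hmn hi))
    (fun m n hmn => le_iInf₂ fun i hi => iInf₂_le i (le_trans hmn hi))]
  exact iSup_mono fun n => le_iInf₂ fun i hi => add_le_add (iInf₂_le i hi) (iInf₂_le i hi)

theorem Gone_le_liminf {D s : ℝ} {V : ℝ → ℝ} (hVc : Continuous V) {u : ℕ → ℝ → ℝ} {φ : ℝ → ℝ}
    (hu : ∀ n, Measurable (u n)) (h : ∀ᵐ x, Tendsto (fun n => u n x) atTop (nhds (φ x))) :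
    Gone D s V φ ≤ liminf (fun n => Gone D s V (u n)) atTop := by
  refine le_trans (add_le_add ?_ ?_) (liminf_add_liminf_le _ _)
  · rw [ENNReal.liminf_const_mul_of_ne_top ENNReal.ofReal_ne_top]
    exact mul_le_mul_right (gag_univ_le_liminf hu h) _
  · refine lintegral_le_liminf_of_ae_tendsto
      (fun n => (hVc.measurable.comp (hu n)).ennreal_ofReal) ?_
    filter_upwards [h] with x hx
    exact ENNReal.tendsto_ofReal ((hVc.tendsto _).comp hx)

theorem eq_zero_of_tendsto_of_lintegral_ne_top {V : ℝ → ℝ} (hV0 : ∀ t, 0 ≤ V t)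
    (hVc : Continuous V) {φ : ℝ → ℝ} (hφm : Measurable φ)
    (hfin : ∫⁻ x, ENNReal.ofReal (V (φ x)) ≠ ⊤) {l : Filter ℝ}
    (hl : ∀ A ∈ l, volume A = ⊤) {L : ℝ} (hφ : Tendsto φ l (nhds L)) : V L = 0 := by
  by_contra hne
  have hpos : 0 < V L := lt_of_le_of_ne (hV0 L) (Ne.symm hne)
  have hev : ∀ᶠ x in l, V L / 2 < V (φ x) :=
    ((hVc.tendsto L).comp hφ).eventually_const_lt (half_lt_self hpos)
  refine hfin (top_le_iff.1 ?_)
  calc ⊤ = ENNReal.ofReal (V L / 2) * volume {x | V L / 2 < V (φ x)} := by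
        rw [hl _ hev, ENNReal.mul_top]
        simpa using hpos
    _ ≤ ENNReal.ofReal (V L / 2) * volume
          {x | ENNReal.ofReal (V L / 2) ≤ ENNReal.ofReal (V (φ x))} :=
        mul_le_mul_right (measure_mono fun x hx => ENNReal.ofReal_le_ofReal hx.le) _
    _ ≤ _ := mul_meas_ge_le_lintegral (hVc.measurable.comp hφm).ennreal_ofReal _

theorem volume_eq_top_of_mem_atTop {A : Set ℝ} (hA : A ∈ (atTop : Filter ℝ)) : volume A = ⊤ := by
  obtain ⟨a, ha⟩ := mem_atTop_sets.1 hA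
  exact top_le_iff.1 ((Real.volume_Ici (a := a)).symm.le.trans (measure_mono ha))

theorem volume_eq_top_of_mem_atBot {A : Set ℝ} (hA : A ∈ (atBot : Filter ℝ)) : volume A = ⊤ := by
  obtain ⟨a, ha⟩ := mem_atBot_sets.1 hA
  exact top_le_iff.1 ((Real.volume_Iic (a := a)).symm.le.trans (measure_mono ha))

theorem kappa_le_Gone {D s α β : ℝ} {V u : ℝ → ℝ} (hu : Measurable u)
    (hbot : Tendsto u atBot (nhds α)) (htop : Tendsto u atTop (nhds β)) :
    kappa D s α β V ≤ Gone D s V u := by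
  by_cases h : Gone D s V u = ⊤
  · exact h ▸ le_top
  · exact sInf_le ⟨u, hu, h, hbot, htop, rfl⟩

/- STATEMENT 13: the optimal profile problem is solvable: κ_s is attained by a
non-decreasing function φ : ℝ → [α', β'] with φ → α' at −∞ and φ → β' at +∞. -/
theorem stmt_13 (a s D α' β' : ℝ) (V : ℝ → ℝ)
    (ha : a ∈ Set.Ioo (-1 : ℝ) 0) (hs : s = (1 - a) / 2) (hD : 0 < D) (hαβ : α' < β')
    (hV0 : ∀ t, 0 ≤ V t) (hVc : Continuous V)
    (hVz : ∀ t, V t = 0 ↔ t = α' ∨ t = β') :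
    ∃ φ : ℝ → ℝ, Monotone φ ∧ (∀ x : ℝ, α' ≤ φ x ∧ φ x ≤ β') ∧
      Tendsto φ atBot (nhds α') ∧ Tendsto φ atTop (nhds β') ∧
      Gone D s V φ = kappa D s α' β' V := by
  have hα : V α' = 0 := (hVz _).2 (Or.inl rfl)
  have hβ : V β' = 0 := (hVz _).2 (Or.inr rfl)
  by_cases hκ : kappa D s α' β' V = ⊤
  · have hmeas : Measurable fun x : ℝ => if x ≤ 0 then α' else β' :=
      Measurable.ite measurableSet_Iic measurable_const measurable_const
    obtain ⟨u, hmono, hmem, -, hbot, htop, -⟩ :=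
      exists_monotone_competitor (D := D) (s := s) hαβ hVc hα hβ hmeas
        (tendsto_const_nhds.congr' <| by
          filter_upwards [eventually_le_atBot 0] with x hx using (if_pos hx).symm)
        (tendsto_const_nhds.congr' <| by
          filter_upwards [eventually_gt_atTop 0] with x hx using (if_neg (not_le.2 hx)).symm)
    refine ⟨u, hmono, hmem, hbot, htop, ?_⟩
    rw [hκ, ← top_le_iff, ← hκ]
    exact kappa_le_Gone hmono.measurable hbot htop
  have hne : {t : ℝ≥0∞ | ∃ v : ℝ → ℝ, Measurable v ∧ Gone D s V v ≠ ⊤ ∧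
      Tendsto v atBot (nhds α') ∧ Tendsto v atTop (nhds β') ∧ t = Gone D s V v}.Nonempty := by
    rw [nonempty_iff_ne_empty]
    intro h
    exact hκ (by rw [kappa, h, _root_.sInf_empty])
  obtain ⟨t, -, htlim, ht⟩ := exists_seq_tendsto_sInf hne (OrderBot.bddBelow _)
  choose v hv _ hvbot hvtop htv using ht
  choose u humono humem hucenter _ _ hule using fun n =>
    exists_monotone_competitor (D := D) (s := s) hαβ hVc hα hβ (hv n) (hvbot n) (hvtop n)
  obtain ⟨ψ, hψ, φ, hφmono, hφmem, hφlim⟩ := exists_subseq_ae_tendsto_of_monotone humono humem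
  have hle : Gone D s V φ ≤ kappa D s α' β' V := by
    refine (Gone_le_liminf hVc (fun n => (humono (ψ n)).measurable) hφlim).trans ?_
    refine (liminf_le_liminf (Eventually.of_forall fun n => ?_)).trans_eq
      (htlim.comp hψ.tendsto_atTop).liminf_eq
    exact (hule (ψ n)).trans_eq (htv (ψ n)).symm
  have hfin : ∫⁻ x, ENNReal.ofReal (V (φ x)) ≠ ⊤ :=
    ne_top_of_le_ne_top hκ (le_add_self.trans hle)
  have hdense := Measure.dense_of_ae hφlim
  have hbb : BddBelow (range φ) := ⟨α', by rintro _ ⟨x, rfl⟩; exact (hφmem x).1⟩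
  have hba : BddAbove (range φ) := ⟨β', by rintro _ ⟨x, rfl⟩; exact (hφmem x).2⟩
  have hbot := tendsto_atBot_ciInf hφmono hbb
  have htop := tendsto_atTop_ciSup hφmono hba
  have hbotα : ⨅ x, φ x = α' := by
    refine ((hVz _).1 (eq_zero_of_tendsto_of_lintegral_ne_top hV0 hVc hφmono.measurable hfin
      (fun A => volume_eq_top_of_mem_atBot) hbot)).resolve_right fun h => ?_
    obtain ⟨x, hx, hx0⟩ := hdense.exists_lt 0
    have h1 : φ x ≤ (α' + β') / 2 :=
      le_of_tendsto' hx fun n => (hucenter _ x).2 hx0.le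
    have h2 : ⨅ x, φ x ≤ φ x := ciInf_le hbb x
    linarith
  have htopβ : ⨆ x, φ x = β' := by
    refine ((hVz _).1 (eq_zero_of_tendsto_of_lintegral_ne_top hV0 hVc hφmono.measurable hfin
      (fun A => volume_eq_top_of_mem_atTop) htop)).resolve_left fun h => ?_
    obtain ⟨x, hx, hx0⟩ := hdense.exists_gt 0
    have h1 : (α' + β') / 2 ≤ φ x :=
      ge_of_tendsto' hx fun n => (not_le.1 fun h => not_le.2 hx0 ((hucenter _ x).1 h)).le
    have h2 : φ x ≤ ⨆ x, φ x := le_ciSup hba x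
    linarith
  rw [hbotα] at hbot
  rw [htopβ] at htop
  exact ⟨φ, hφmono, hφmem, hbot, htop, hle.antisymm (kappa_le_Gone hφmono.measurable hbot htop)⟩
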